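/- Let m ∈ L¹(Ω) be possibly sign-changing, and suppose there exists an open subinterval Ω₀ ⊂ Ω such that m ≥ 0 a.e. in Ω₀ and m ≢ 0 in Ω₀. Assume hypothesis H1 on φ and hypothesis F1 on f with lim_{t→0⁺} t^q/ψ(t) = ∞ (so that the hypotheses of Theorem nuevo (i) hold with m⁺ := max(m,0) in place of m). Then for every λ > 0 there exists a nonnegative nontrivial solution u = u_λ ∈ C¹([a,b]) of −(φ(u′))′ = λ m(x) f(u) in Ω, u = 0 on ∂Ω, i.e. u ≥ 0 on [a,b] and u ≢ 0. -/

import Mathlib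

open MeasureTheory Set Filter

/-- `u` is a solution of `-(φ(u'))' = h` in `Ω = (a,b)`, `u = 0` on `∂Ω`. -/
def IsSol (a b : ℝ) (φ h u u' : ℝ → ℝ) : Prop :=
  u a = 0 ∧ u b = 0 ∧
  ContinuousOn u' (Set.Icc a b) ∧
  (∀ x ∈ Set.Icc a b, HasDerivWithinAt u (u' x) (Set.Icc a b) x) ∧
  (∀ x ∈ Set.Icc a b, φ (u' x) = φ (u' a) - ∫ t in a..x, h t)

lemma comp_aux (φ : ℝ → ℝ) (hmono : StrictMono φ) (p r : ℝ) 
    (u w u' w' : ℝ → ℝ) (hu : ContinuousOn u (Icc p r)) (hw : ContinuousOn w (Icc p r))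
    (hu' : ∀ x ∈ Ioo p r, HasDerivAt u (u' x) x) (hw' : ∀ x ∈ Ioo p r, HasDerivAt w (w' x) x)
    (hp : w p ≤ u p) (hr : w r ≤ u r)
    (hc : ∀ x y, p < x → x ≤ y → y < r → (∀ t ∈ Icc x y, u t < w t) →
      φ (u' y) - φ (u' x) ≤ φ (w' y) - φ (w' x)) :
    ∀ x ∈ Icc p r, w x ≤ u x := by
  by_contra! hcon
  obtain ⟨x, hx, hlt⟩ := hcon
  have hg : ContinuousOn (fun t => u t - w t) (Icc p r) := hu.sub hw
  obtain ⟨z, hz, hzmin⟩ := isCompact_Icc.exists_isMinOn ⟨x, hx⟩ hg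
  have hz0 : u z - w z < 0 := lt_of_le_of_lt (hzmin hx) (by linarith)
  have hzp : p < z := lt_of_le_of_ne hz.1 (by rintro rfl; linarith)
  have hzr : z < r := lt_of_le_of_ne hz.2 (by rintro rfl; linarith)
  have hloc : IsLocalMin (fun t => u t - w t) z :=
    hzmin.isLocalMin (Icc_mem_nhds hzp hzr)
  have hd := hloc.hasDerivAt_eq_zero ((hu' z ⟨hzp, hzr⟩).sub (hw' z ⟨hzp, hzr⟩))
  have hsub : Icc z r ⊆ Icc p r := Icc_subset_Icc_left hz.1
  set A : Set ℝ := Icc z r ∩ (fun t => u t - w t) ⁻¹' (Ici 0) with hA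
  have hAc : IsClosed A := (hg.mono hsub).preimage_isClosed_of_isClosed isClosed_Icc isClosed_Ici
  have hrA : r ∈ A := ⟨⟨hzr.le, le_rfl⟩, by simpa using hr⟩
  have hAb : BddBelow A := ⟨z, fun t ht => ht.1.1⟩
  have hyA : sInf A ∈ A := hAc.csInf_mem ⟨r, hrA⟩ hAb
  set y := sInf A with hy
  have hlow : ∀ t, z ≤ t → t < y → u t < w t := by
    intro t h1 h2
    by_contra! h3
    have : t ∈ A := ⟨⟨h1, h2.le.trans hyA.1.2⟩, by simpa using h3⟩
    exact absurd (csInf_le hAb this) (not_le.2 h2)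
  have hanti : AntitoneOn (fun t => u t - w t) (Icc z y) := by
    have hdd : ∀ t ∈ Ioo z y, HasDerivAt (fun t => u t - w t) (u' t - w' t) t := fun t ht => by
      have : t ∈ Ioo p r := ⟨hzp.trans ht.1, ht.2.trans_le hyA.1.2⟩
      exact (hu' t this).sub (hw' t this)
    apply antitoneOn_of_deriv_nonpos (convex_Icc z y)
    · exact hg.mono (Icc_subset_Icc hz.1 hyA.1.2)
    · rw [interior_Icc]
      exact fun t ht => (hdd t ht).differentiableAt.differentiableWithinAt
    · rw [interior_Icc]
      intro t ht
      rw [(hdd t ht).deriv]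
      have := hc z t hzp ht.1.le (ht.2.trans_le hyA.1.2)
        (fun τ hτ => hlow τ hτ.1 (hτ.2.trans_lt ht.2))
      have e : u' z = w' z := by linarith
      rw [e] at this
      have h4 : φ (u' t) ≤ φ (w' t) := by linarith
      have := hmono.le_iff_le.1 h4
      linarith
  have h5 := hanti ⟨le_rfl, hyA.1.1⟩ ⟨hyA.1.1, le_rfl⟩ hyA.1.1
  have h6 : 0 ≤ u y - w y := hyA.2
  simp only at h5
  linarith

lemma inner_integrable (m v : ℝ → ℝ) (hm : Integrable m) (hv : Continuous v) (B : ℝ)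
    (hB : ∀ x, |v x| ≤ B) : Integrable (fun r => m r * v r) :=
  hm.mul_bdd hv.aestronglyMeasurable (Eventually.of_forall hB)

lemma inner_bound (m v : ℝ → ℝ) (hm : Integrable m) (hv : Continuous v) (B : ℝ) 
    (hB : ∀ x, |v x| ≤ B) (a t : ℝ) : |∫ r in a..t, m r * v r| ≤ B * ∫ r, |m r| := by
  have h1 := inner_integrable m v hm hv B hB
  calc |∫ r in a..t, m r * v r| ≤ ∫ r in uIoc a t, ‖m r * v r‖ :=
by
        rw [← Real.norm_eq_abs]; exact intervalIntegral.norm_integral_le_integral_norm_uIoc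
    _ ≤ ∫ r, ‖m r * v r‖ := setIntegral_le_integral h1.norm (Eventually.of_forall fun _ => norm_nonneg _)
    _ ≤ ∫ r, B * |m r| := by
        apply integral_mono h1.norm (hm.abs.const_mul B)
        intro r
        simp only [norm_mul, Real.norm_eq_abs]
        rw [mul_comm]
        exact mul_le_mul_of_nonneg_right (hB r) (abs_nonneg _)
    _ = _ := integral_const_mul _ _

lemma prim_cont (m : ℝ → ℝ) (hm : Integrable m) (G : ℝ → ℝ → ℝ) (hG : Continuous (Function.uncurry G))
    (B : ℝ) (hB : ∀ c x, |G c x| ≤ B) (a : ℝ) :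
    Continuous (fun p : ℝ × ℝ => ∫ r in a..p.2, m r * G p.1 r) := by
  rw [continuous_iff_continuousAt]
  rintro ⟨c₀, t₀⟩
  apply intervalIntegral.continuousAt_parametric_primitive_of_dominated (F := fun c r => m r * G c r)
    (fun r => B * |m r|) (min a t₀ - 1) (max a t₀ + 1)
  · intro c
    have : Continuous (G c) := by fun_prop
    exact (hm.aestronglyMeasurable.mul this.aestronglyMeasurable).restrict
  · refine Eventually.of_forall fun c => Eventually.of_forall fun r => ?_
    simp only [norm_mul, Real.norm_eq_abs]
    rw [mul_comm]
    exact mul_le_mul_of_nonneg_right (hB c r) (abs_nonneg _)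
  · exact (hm.abs.const_mul B).intervalIntegrable
  · refine Eventually.of_forall fun r => ?_
    have : Continuous (fun c => m r * G c r) := by fun_prop
    exact this.continuousAt
  · constructor
    · linarith [min_le_left a t₀]
    · linarith [le_max_left a t₀]
  · constructor
    · linarith [min_le_right a t₀]
    · linarith [le_max_right a t₀]
  · simp

noncomputable def delayIter (φi m : ℝ → ℝ) (g : ℝ → ℝ → ℝ) (a h : ℝ) : ℕ → ℝ → ℝ → ℝ
  | 0, _, _ => 0
  | k+1, c, x => ∫ t in a..x, φi (c - ∫ r in a..t, m r * g r (delayIter φi m g a h k c (max a (r - h))))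

lemma delayIter_cont (φi m : ℝ → ℝ) (g : ℝ → ℝ → ℝ) (a h : ℝ) (hφ : Continuous φi)
    (hm : Integrable m) (hg : Continuous (Function.uncurry g)) (B : ℝ) (hB : ∀ x y, |g x y| ≤ B) (k : ℕ) :
    Continuous (Function.uncurry (delayIter φi m g a h k)) := by
  induction k with
  | zero => 
    have : Function.uncurry (delayIter φi m g a h 0) = fun _ => 0 := by
      ext ⟨c, x⟩; rfl
    rw [this]; exact continuous_const
  | succ k ih =>
    have hG : Continuous (Function.uncurry fun c r => g r (delayIter φi m g a h k c (max a (r - h)))) := by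
      have h2 : Continuous (fun p : ℝ × ℝ => delayIter φi m g a h k p.1 (max a (p.2 - h))) :=
        ih.comp (by fun_prop : Continuous (fun p : ℝ × ℝ => (p.1, max a (p.2 - h))))
      exact hg.comp (continuous_snd.prodMk h2)
    have h1 := prim_cont m hm _ hG B (fun c x => hB _ _) a
    have h3 : Continuous (Function.uncurry fun c t => φi (c - ∫ r in a..t, m r * g r (delayIter φi m g a h k c (max a (r - h))))) :=
      hφ.comp (continuous_fst.sub h1)
    exact intervalIntegral.continuous_parametric_primitive_of_continuous h3

lemma delayIter_stab (φi m : ℝ → ℝ) (g : ℝ → ℝ → ℝ) (a h : ℝ) (hh : 0 < h) (c : ℝ) (k : ℕ) :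
    ∀ x ∈ Icc a (a + k * h), delayIter φi m g a h (k+1) c x = delayIter φi m g a h k c x := by
  induction k with
  | zero => 
    intro x hx
    have : x = a := by simp at hx; linarith
    subst this
    simp [delayIter]
  | succ k ih =>
    intro x hx
    rw [delayIter, delayIter]
    apply intervalIntegral.integral_congr
    intro t ht
    rw [uIcc_of_le hx.1] at ht
    simp only
    congr 2
    apply intervalIntegral.integral_congr
    intro r hr
    rw [uIcc_of_le ht.1] at hr
    simp only
    rw [ih]
    constructor
    · exact le_max_left _ _
    · have := hr.2.trans (ht.2.trans hx.2)
      push_cast at this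
      apply max_le
      · nlinarith [(Nat.cast_nonneg k : (0:ℝ) ≤ k)]
      · linarith

lemma delay_exists (a b : ℝ) (hab : a < b) (φi m : ℝ → ℝ) (g : ℝ → ℝ → ℝ) (h : ℝ) (hh : 0 < h)
    (hφ : Continuous φi) (hmo : Monotone φi) (h0 : φi 0 = 0)
    (hm : Integrable m) (hg : Continuous (Function.uncurry g)) (B R : ℝ) (hB : ∀ x y, |g x y| ≤ B) 
    (hR : B * ∫ r, |m r| ≤ R) :
    ∃ c ∈ Icc (-R) R, ∃ u : ℝ → ℝ, Continuous u ∧ u b = 0 ∧ ∀ x ∈ Icc a b,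
      u x = ∫ t in a..x, φi (c - ∫ r in a..t, m r * g r (u (max a (r - h)))) := by
  obtain ⟨k, hk⟩ := exists_nat_gt ((b - a) / h)
  rw [div_lt_iff₀ hh] at hk
  have hC := fun k => delayIter_cont φi m g a h hφ hm hg B hB k
  have hbd : ∀ c t, |∫ r in a..t, m r * g r (delayIter φi m g a h k c (max a (r - h)))| ≤ R := by
    intro c t
    refine (inner_bound m _ hm ?_ B (fun x => hB _ _) a t).trans hR
    have h2 : Continuous (fun r : ℝ => delayIter φi m g a h k c (max a (r - h))) :=
      (hC k).comp (by fun_prop : Continuous (fun r : ℝ => (c, max a (r - h))))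
    exact hg.comp (continuous_id.prodMk h2)
  have hR0 : 0 ≤ R := (abs_nonneg _).trans (hbd 0 0)
  have hcc : Continuous (fun c => delayIter φi m g a h (k+1) c b) :=
    (hC (k+1)).comp (by fun_prop : Continuous (fun c : ℝ => (c, b)))
  have hlo : delayIter φi m g a h (k+1) (-R) b ≤ 0 := by
    rw [delayIter]
    rw [← neg_nonneg, ← intervalIntegral.integral_neg]
    apply intervalIntegral.integral_nonneg_of_forall hab.le
    intro t
    rw [neg_nonneg, ← h0]
    apply hmo
    linarith [neg_le_of_abs_le (hbd (-R) t)]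
  have hhi : 0 ≤ delayIter φi m g a h (k+1) R b := by
    rw [delayIter]
    apply intervalIntegral.integral_nonneg_of_forall hab.le
    intro t
    rw [← h0]
    apply hmo
    linarith [le_of_abs_le (hbd (R) t)]
  obtain ⟨c, hc, hcb⟩ := intermediate_value_Icc (by linarith : -R ≤ R) hcc.continuousOn ⟨hlo, hhi⟩
  refine ⟨c, hc, delayIter φi m g a h k c, ?_, ?_, ?_⟩
  · exact (hC k).comp (by fun_prop : Continuous (fun x : ℝ => (c, x)))
  · rw [← hcb]
    simp only
    rw [delayIter_stab φi m g a h hh c k b ⟨hab.le, by linarith⟩]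
  · intro x hx
    rw [← delayIter_stab φi m g a h hh c k x ⟨hx.1, by linarith [hx.2]⟩, delayIter]

lemma exists_bvp (a b : ℝ) (hab : a < b) (φi m : ℝ → ℝ) (g : ℝ → ℝ → ℝ)
    (hφ : Continuous φi) (hmo : Monotone φi) (hod : ∀ x, φi (-x) = - φi x)
    (hm : Integrable m) (hg : Continuous (Function.uncurry g)) (B R : ℝ) (hB : ∀ x y, |g x y| ≤ B)
    (hR : B * ∫ r, |m r| ≤ R) :
    ∃ c ∈ Icc (-R) R, ∃ u : ℝ → ℝ, Continuous u ∧ u b = 0 ∧ ∀ x ∈ Icc a b,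
      u x = ∫ t in a..x, φi (c - ∫ r in a..t, m r * g r (u r)) := by
  have h0 : φi 0 = 0 := by have := hod 0; simp at this; linarith
  have hpos : ∀ n : ℕ, (0:ℝ) < 1 / ((n:ℝ) + 1) := fun n => by positivity
  choose c hc u huc hub hu using fun n : ℕ =>
    delay_exists a b hab φi m g (1 / ((n:ℝ) + 1)) (hpos n) hφ hmo h0 hm hg B R hB hR
  set L := φi (2 * R) with hL
  have hvc : ∀ n, Continuous (fun r => g r (u n (max a (r - 1 / ((n:ℝ) + 1))))) := fun n =>
    hg.comp (continuous_id.prodMk ((huc n).comp (by fun_prop)))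
  have hbd : ∀ n t, |∫ r in a..t, m r * g r (u n (max a (r - 1 / ((n:ℝ) + 1))))| ≤ R := fun n t =>
    (inner_bound m _ hm (hvc n) B (fun x => hB _ _) a t).trans hR
  have hφb : ∀ y, |y| ≤ 2 * R → |φi y| ≤ L := by
    intro y hy
    rw [abs_le] at hy ⊢
    exact ⟨by rw [hL, ← hod]; exact hmo hy.1, hmo hy.2⟩
  have hDb : ∀ n t, |φi (c n - ∫ r in a..t, m r * g r (u n (max a (r - 1 / ((n:ℝ) + 1)))))| ≤ L := by
    intro n t
    apply hφb
    have h1 := abs_le.1 (hbd n t)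
    have h2 := hc n
    rw [abs_le]
    constructor <;> linarith [h1.1, h1.2, h2.1, h2.2]
  have hDc : ∀ n, Continuous (fun t => φi (c n - ∫ r in a..t, m r * g r (u n (max a (r - 1 / ((n:ℝ) + 1)))))) := by
    intro n
    apply hφ.comp
    apply continuous_const.sub
    exact intervalIntegral.continuous_primitive
      (fun x y => (inner_integrable m _ hm (hvc n) B (fun x => hB _ _)).intervalIntegrable) a
  have hL0 : 0 ≤ L := (abs_nonneg _).trans (hDb 0 0)
  have hlip : ∀ n, ∀ x ∈ Icc a b, ∀ y ∈ Icc a b, |u n x - u n y| ≤ L * |x - y| := by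
    intro n x hx y hy
    rw [hu n x hx, hu n y hy, intervalIntegral.integral_interval_sub_left
      ((hDc n).intervalIntegrable _ _) ((hDc n).intervalIntegrable _ _)]
    rw [← Real.norm_eq_abs]
    exact intervalIntegral.norm_integral_le_of_norm_le_const fun t _ => hDb n t
  have hua : ∀ n, u n a = 0 := fun n => by rw [hu n a ⟨le_rfl, hab.le⟩]; simp
  -- compactness
  let v : ℕ → BoundedContinuousFunction (Icc a b) ℝ := fun n =>
    BoundedContinuousFunction.mkOfCompact ⟨fun x => u n x, (huc n).comp continuous_subtype_val⟩
  let A : Set (BoundedContinuousFunction (Icc a b) ℝ) :=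
    {w | ∀ x y, |w x - w y| ≤ L * dist x y} ∩ {w | ∀ x, |w x| ≤ L * (b - a)}
  have hev : ∀ x : Icc a b, Continuous (fun w : BoundedContinuousFunction (Icc a b) ℝ => w x) :=
    fun x => continuous_eval_const x
  have hA : IsCompact A := by
    apply BoundedContinuousFunction.arzela_ascoli₂ (Icc (-(L * (b - a))) (L * (b - a))) isCompact_Icc
    · apply IsClosed.inter
      · simp only [ ofPred_forall]
        refine isClosed_iInter fun x => isClosed_iInter fun y => ?_
        exact isClosed_le ((hev x).sub (hev y)).abs continuous_const
      · simp only [ ofPred_forall]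
        refine isClosed_iInter fun x => ?_
        exact isClosed_le (hev x).abs continuous_const
    · intro w x hw
      exact abs_le.1 (hw.2 x)
    · apply LipschitzWith.uniformEquicontinuous _ ⟨L, hL0⟩ _ |>.equicontinuous
      intro w
      apply LipschitzWith.of_dist_le_mul
      intro x y
      exact w.2.1 x y
  have hvA : ∀ n, v n ∈ A := by
    intro n
    constructor
    · intro x y
      exact hlip n x x.2 y y.2
    · intro x
      have h1 := hlip n x x.2 a ⟨le_rfl, hab.le⟩
      rw [hua n, sub_zero] at h1
      refine h1.trans (mul_le_mul_of_nonneg_left ?_ hL0)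
      rw [abs_of_nonneg (by linarith [x.2.1])]
      linarith [x.2.2]
  obtain ⟨w, hw, σ, hσ, hσt⟩ := hA.tendsto_subseq hvA
  obtain ⟨c', hc', τ, hτ, hτt⟩ := (isCompact_Icc (a := -R) (b := R)).tendsto_subseq (fun n => hc (σ n))
  let s : ℕ → ℕ := fun n => σ (τ n)
  have hs : Tendsto s atTop atTop := hσ.tendsto_atTop.comp hτ.tendsto_atTop
  let U : ℝ → ℝ := IccExtend hab.le w
  have hUc : Continuous U := w.continuous.Icc_extend'
  have hU : ∀ x ∈ Icc a b, Tendsto (fun n => u (s n) x) atTop (nhds (U x)) := by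
    intro x hx
    have h1 := ((hev ⟨x, hx⟩).tendsto w).comp (hσt.comp hτ.tendsto_atTop)
    have h2 : U x = w ⟨x, hx⟩ := IccExtend_of_mem hab.le w hx
    rw [h2]
    exact h1
  have hUd : ∀ x ∈ Icc a b, Tendsto (fun n => u (s n) (max a (x - 1 / ((s n:ℝ) + 1)))) atTop (nhds (U x)) := by
    intro x hx
    have hz : Tendsto (fun n => L * (1 / ((s n:ℝ) + 1))) atTop (nhds 0) := by
      have := (tendsto_one_div_add_atTop_nhds_zero_nat (𝕜 := ℝ)).comp hs
      simpa using this.const_mul L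
    have h3 : Tendsto (fun n => u (s n) (max a (x - 1 / ((s n:ℝ) + 1))) - u (s n) x) atTop (nhds 0) := by
      apply squeeze_zero_norm _ hz
      intro n
      have hp := hpos (s n)
      have hmem : max a (x - 1 / ((s n:ℝ) + 1)) ∈ Icc a b :=
        ⟨le_max_left _ _, max_le hab.le (by linarith [hx.2])⟩
      refine (hlip (s n) _ hmem x hx).trans (mul_le_mul_of_nonneg_left ?_ hL0)
      rw [abs_le]
      constructor
      · linarith [le_max_right a (x - 1 / ((s n:ℝ) + 1))]
      · have : max a (x - 1 / ((s n:ℝ) + 1)) ≤ x := max_le hx.1 (by linarith)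
        linarith
    simpa using h3.add (hU x hx)
  have hI : ∀ t ∈ Icc a b, Tendsto (fun n => ∫ r in a..t, m r * g r (u (s n) (max a (r - 1 / ((s n:ℝ) + 1)))))
      atTop (nhds (∫ r in a..t, m r * g r (U r))) := by
    intro t ht
    apply intervalIntegral.tendsto_integral_filter_of_dominated_convergence (fun r => B * |m r|)
    · refine Eventually.of_forall fun n => ?_
      exact (hm.aestronglyMeasurable.mul (hvc (s n)).aestronglyMeasurable).restrict
    · refine Eventually.of_forall fun n => Eventually.of_forall fun r _ => ?_
      simp only [norm_mul, Real.norm_eq_abs]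
      rw [mul_comm]
      exact mul_le_mul_of_nonneg_right (hB _ _) (abs_nonneg _)
    · exact (hm.abs.const_mul B).intervalIntegrable
    · refine Eventually.of_forall fun r hr => ?_
      rw [uIoc_of_le ht.1] at hr
      have hr' : r ∈ Icc a b := ⟨hr.1.le, hr.2.trans ht.2⟩
      apply Tendsto.const_mul
      have h5 : Continuous (fun y => g r y) := hg.comp (by fun_prop : Continuous fun y : ℝ => (r, y))
      exact (h5.tendsto _).comp (hUd r hr')
  refine ⟨c', hc', U, hUc, ?_, ?_⟩
  · have := hU b ⟨hab.le, le_rfl⟩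
    simp only [hub] at this
    exact (tendsto_const_nhds_iff.1 this).symm
  · intro x hx
    refine tendsto_nhds_unique (hU x hx) ?_
    simp only [hu _ x hx]
    apply intervalIntegral.tendsto_integral_filter_of_dominated_convergence (fun _ => L)
    · exact Eventually.of_forall fun n => (hDc (s n)).aestronglyMeasurable
    · exact Eventually.of_forall fun n => Eventually.of_forall fun r _ => hDb (s n) r
    · exact intervalIntegrable_const
    · refine Eventually.of_forall fun t ht => ?_
      rw [uIoc_of_le hx.1] at ht
      have ht' : t ∈ Icc a b := ⟨ht.1.le, ht.2.trans hx.2⟩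
      exact (hφ.tendsto _).comp (Tendsto.sub hτt (hI t ht'))

lemma sub_aux (φi k : ℝ → ℝ) (hφ : Continuous φi) (hmo : Monotone φi) (P s x₀ η : ℝ) (hη : 0 < η)
    (hs : 0 ≤ s) (hP : φi P = s) (hP' : φi (-P) = -s) (hk : Integrable k) (hk0 : 0 ≤ᵐ[volume] k)
    (hks : ∀ x, x ∉ Ioc (x₀ - η) (x₀ + η) → k x = 0) (hkP : ∫ x, k x = 2 * P) :
    ∃ w : ℝ → ℝ, (∀ x, HasDerivAt w (φi (P - ∫ t in Iic x, k t)) x) ∧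
      (∀ x ∈ Icc (x₀ - η) (x₀ + η), s * η ≤ w x) ∧
      (∀ x, x ≤ x₀ - 4 * η → w x ≤ 0) ∧ (∀ x, x₀ + 4 * η ≤ x → w x ≤ 0) ∧
      (∀ x, w x ≤ 6 * s * η) := by
  set K : ℝ → ℝ := fun x => ∫ t in Iic x, k t with hK
  have hK0 : ∀ x, 0 ≤ K x := fun x => integral_nonneg_of_ae (ae_restrict_of_ae hk0)
  have hK1 : ∀ x, K x ≤ 2 * P := fun x => by
    rw [← hkP]; exact setIntegral_le_integral hk hk0
  have hKl : ∀ x, x ≤ x₀ - η → K x = 0 := by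
    intro x hx
    apply setIntegral_eq_zero_of_forall_eq_zero
    intro t ht
    apply hks
    intro h
    have : t ≤ x := ht
    linarith [h.1]
  have hKr : ∀ x, x₀ + η ≤ x → K x = 2 * P := by
    intro x hx
    rw [← hkP]
    apply setIntegral_eq_integral_of_forall_compl_eq_zero
    intro t ht
    apply hks
    intro h
    apply ht
    exact h.2.trans hx
  have hKc : Continuous K := by
    have : K = fun x => K 0 + ∫ t in (0:ℝ)..x, k t := by
      ext x
      rw [← intervalIntegral.integral_Iic_sub_Iic hk.integrableOn hk.integrableOn]
      simp [hK]
    rw [this]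
    exact continuous_const.add
      (intervalIntegral.continuous_primitive (fun x y => hk.intervalIntegrable) 0)
  set D : ℝ → ℝ := fun x => φi (P - K x) with hD
  have hDc : Continuous D := hφ.comp (continuous_const.sub hKc)
  have hDb : ∀ x, |D x| ≤ s := by
    intro x
    rw [abs_le, ← hP', ← hP]
    exact ⟨hmo (by linarith [hK1 x]), hmo (by linarith [hK0 x])⟩
  have hDl : ∀ x, x ≤ x₀ - η → D x = s := by
    intro x hx; simp [hD, hKl x hx, hP]
  have hDr : ∀ x, x₀ + η ≤ x → D x = -s := by
    intro x hx; simp only [hD, hKr x hx]; rw [← hP']; congr 1; ring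
  set w : ℝ → ℝ := fun x => 2 * s * η + ∫ t in x₀..x, D t with hw
  have hlip : ∀ x, |w x - 2 * s * η| ≤ s * |x - x₀| := by
    intro x
    simp only [hw, add_sub_cancel_left]
    rw [← Real.norm_eq_abs]
    exact intervalIntegral.norm_integral_le_of_norm_le_const fun t _ => hDb t
  have hr4 : ∀ x, x₀ + 4 * η ≤ x → w x ≤ 0 := by
    intro x hx
    have h1 : w x = w (x₀ + η) + ∫ t in (x₀+η)..x, D t := by
      simp only [hw]
      rw [add_assoc, intervalIntegral.integral_add_adjacent_intervals
        (hDc.intervalIntegrable _ _) (hDc.intervalIntegrable _ _)]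
    have h2 : ∫ t in (x₀+η)..x, D t = ∫ t in (x₀+η)..x, -s := by
      apply intervalIntegral.integral_congr
      intro t ht
      rw [uIcc_of_le (by linarith)] at ht
      exact hDr t ht.1
    rw [h1, h2, intervalIntegral.integral_const, smul_eq_mul]
    have h3 := (abs_le.1 (hlip (x₀ + η))).2
    have h4 : |x₀ + η - x₀| = η := by
      rw [show x₀ + η - x₀ = η by ring, abs_of_pos hη]
    rw [h4] at h3
    nlinarith
  have hl4 : ∀ x, x ≤ x₀ - 4 * η → w x ≤ 0 := by
    intro x hx
    have h1 : w x = w (x₀ - η) + ∫ t in (x₀-η)..x, D t := by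
      simp only [hw]
      rw [add_assoc, intervalIntegral.integral_add_adjacent_intervals
        (hDc.intervalIntegrable _ _) (hDc.intervalIntegrable _ _)]
    have h2 : ∫ t in (x₀-η)..x, D t = ∫ t in (x₀-η)..x, s := by
      apply intervalIntegral.integral_congr
      intro t ht
      rw [uIcc_of_ge (by linarith)] at ht
      exact hDl t ht.2
    rw [h1, h2, intervalIntegral.integral_const, smul_eq_mul]
    have h3 := (abs_le.1 (hlip (x₀ - η))).2
    have h4 : |x₀ - η - x₀| = η := by
      rw [show x₀ - η - x₀ = -η by ring, abs_neg, abs_of_pos hη]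
    rw [h4] at h3
    nlinarith
  refine ⟨w, ?_, ?_, hl4, hr4, ?_⟩
  · intro x
    exact (hDc.integral_hasStrictDerivAt x₀ x).hasDerivAt.const_add _
  · intro x hx
    have h3 := (abs_le.1 (hlip x)).1
    have : |x - x₀| ≤ η := abs_le.2 ⟨by linarith [hx.1], by linarith [hx.2]⟩
    nlinarith
  · intro x
    have hsη : 0 ≤ s * η := by positivity
    rcases le_total x (x₀ - 4 * η) with h | h
    · linarith [hl4 x h]
    rcases le_total (x₀ + 4 * η) x with h' | h'
    · linarith [hr4 x h']
    have h3 := (abs_le.1 (hlip x)).2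
    have : |x - x₀| ≤ 4 * η := abs_le.2 ⟨by linarith, by linarith⟩
    nlinarith

lemma growth_aux (φ : ℝ → ℝ) (hodd : ∀ x, φ (-x) = -φ x) (hmono : StrictMono φ)
    (t₁ : ℝ) (ht₁ : 0 < t₁) (ψ : ℝ → ℝ)
    (hψmono : StrictMonoOn ψ (Set.Icc 0 t₁)) (hψ0 : ψ 0 = 0)
    (hH1 : ∀ t ∈ Set.Icc (0:ℝ) t₁, ∀ x ≥ (0:ℝ), φ (t * x) ≤ ψ t * φ x) (q : ℝ)
    (hnu : Tendsto (fun t : ℝ => t ^ q / ψ t) (nhdsWithin 0 (Set.Ioi 0)) atTop)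
    (K σ : ℝ) (hσ : 0 < σ) :
    ∃ t, 0 < t ∧ t < σ ∧ 0 < ψ t ∧ φ t ≤ ψ t * φ 1 ∧ φ 1 ≤ ψ t * φ t⁻¹ ∧ K * ψ t ≤ t ^ q := by
  have h1 := hnu.eventually_ge_atTop K
  have h2 : ∀ᶠ t in nhdsWithin (0:ℝ) (Ioi 0), t ∈ Ioo 0 (min σ t₁) :=
    Ioo_mem_nhdsGT (lt_min hσ ht₁)
  obtain ⟨t, ht, ht'⟩ := (h1.and h2).exists
  have htm : t ∈ Icc 0 t₁ := ⟨ht'.1.le, (ht'.2.trans_le (min_le_right _ _)).le⟩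
  have hp : 0 < ψ t := by
    rw [← hψ0]; exact hψmono ⟨le_rfl, ht₁.le⟩ htm ht'.1
  refine ⟨t, ht'.1, ht'.2.trans_le (min_le_left _ _), hp, ?_, ?_, ?_⟩
  · simpa using hH1 t htm 1 zero_le_one
  · have := hH1 t htm t⁻¹ (inv_nonneg.2 ht'.1.le)
    rwa [mul_inv_cancel₀ ht'.1.ne'] at this
  · exact (le_div_iff₀ hp).1 ht

lemma growth_small (φ : ℝ → ℝ) (hodd : ∀ x, φ (-x) = -φ x) (hmono : StrictMono φ)
    (t₁ : ℝ) (ht₁ : 0 < t₁) (ψ : ℝ → ℝ)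
    (hψmono : StrictMonoOn ψ (Set.Icc 0 t₁)) (hψ0 : ψ 0 = 0)
    (hH1 : ∀ t ∈ Set.Icc (0:ℝ) t₁, ∀ x ≥ (0:ℝ), φ (t * x) ≤ ψ t * φ x) (q : ℝ)
    (hnu : Tendsto (fun t : ℝ => t ^ q / ψ t) (nhdsWithin 0 (Set.Ioi 0)) atTop)
    (ε σ : ℝ) (hε : 0 < ε) (hσ : 0 < σ) :
    ∃ s, 0 < s ∧ s < σ ∧ φ s ≤ ε * s ^ q := by
  obtain ⟨t, h1, h2, h3, h4, h5, h6⟩ := growth_aux φ hodd hmono t₁ ht₁ ψ hψmono hψ0 hH1 q hnu (φ 1 / ε) σ hσ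
  refine ⟨t, h1, h2, h4.trans ?_⟩
  calc ψ t * φ 1 = ε * (φ 1 / ε * ψ t) := by field_simp
    _ ≤ _ := mul_le_mul_of_nonneg_left h6 hε.le

lemma growth_large (φ : ℝ → ℝ) (hodd : ∀ x, φ (-x) = -φ x) (hmono : StrictMono φ)
    (t₁ : ℝ) (ht₁ : 0 < t₁) (ψ : ℝ → ℝ)
    (hψmono : StrictMonoOn ψ (Set.Icc 0 t₁)) (hψ0 : ψ 0 = 0)
    (hH1 : ∀ t ∈ Set.Icc (0:ℝ) t₁, ∀ x ≥ (0:ℝ), φ (t * x) ≤ ψ t * φ x) (q : ℝ)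
    (hnu : Tendsto (fun t : ℝ => t ^ q / ψ t) (nhdsWithin 0 (Set.Ioi 0)) atTop)
    (K : ℝ) (hK : 0 < K) :
    ∃ T, 0 < T ∧ K * T ^ q ≤ φ T := by
  have h0 : φ 0 = 0 := by have := hodd 0; simp at this; linarith
  have hφ1 : 0 < φ 1 := by rw [← h0]; exact hmono one_pos
  obtain ⟨t, h1, h2, h3, h4, h5, h6⟩ := growth_aux φ hodd hmono t₁ ht₁ ψ hψmono hψ0 hH1 q hnu (K / φ 1) 1 one_pos
  refine ⟨t⁻¹, inv_pos.2 h1, ?_⟩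
  rw [Real.inv_rpow h1.le]
  have hq : 0 < t ^ q := Real.rpow_pos_of_pos h1 q
  rw [← div_eq_mul_inv, div_le_iff₀ hq]
  have h7 : K * ψ t ≤ t ^ q * φ 1 := by
    have := mul_le_mul_of_nonneg_right h6 hφ1.le
    calc K * ψ t = K / φ 1 * ψ t * φ 1 := by field_simp
      _ ≤ _ := this
  have hT : 0 < φ t⁻¹ := by rw [← h0]; exact hmono (inv_pos.2 h1)
  have h8 : K * ψ t ≤ φ t⁻¹ * t ^ q * ψ t := by nlinarith
  exact le_of_mul_le_mul_right h8 h3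

/-- Corollary cori for sign-changing `m`. If `m ∈ L¹(Ω)` and
there is an open subinterval `Ω₀ = (a₀,b₀) ⊂ Ω` with `0 ≤ m ≢ 0` in `Ω₀`, and
H1, F1 together with `lim_{t→0⁺} t^q/ψ(t) = ∞` hold, then for every `λ > 0`
there is a nonnegative nontrivial solution of `-(φ(u'))' = λ m f(u)`,
`u = 0` on `∂Ω`. -/
theorem existence_sign_changing
    (a b : ℝ) (hab : a < b)
    (φ : ℝ → ℝ) (hodd : ∀ x, φ (-x) = -φ x) (hmono : StrictMono φ)
    (hcont : Continuous φ) (hsurj : Function.Surjective φ)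
    (f : ℝ → ℝ) (hfc : ContinuousOn f (Set.Ici 0)) (hf0 : ∀ t ≥ (0:ℝ), 0 ≤ f t)
    (m : ℝ → ℝ) (hm : IntegrableOn m (Set.Ioo a b))
    -- the open subinterval Ω₀ = (a₀,b₀) ⊂ Ω with 0 ≤ m ≢ 0 in Ω₀
    (a₀ b₀ : ℝ) (ha₀ : a ≤ a₀) (hab₀ : a₀ < b₀) (hb₀ : b₀ ≤ b)
    (hm0 : ∀ᵐ x ∂(volume.restrict (Set.Ioo a₀ b₀)), 0 ≤ m x)
    (hmne : ¬ (∀ᵐ x ∂(volume.restrict (Set.Ioo a₀ b₀)), m x = 0))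
    -- hypothesis H1
    (t₁ : ℝ) (ht₁ : 0 < t₁) (ψ : ℝ → ℝ)
    (hψmono : StrictMonoOn ψ (Set.Icc 0 t₁)) (hψcont : ContinuousOn ψ (Set.Icc 0 t₁))
    (hψ0 : ψ 0 = 0)
    (hH1 : ∀ t ∈ Set.Icc (0:ℝ) t₁, ∀ x ≥ (0:ℝ), φ (t * x) ≤ ψ t * φ x)
    -- hypothesis F1
    (tbar k₁ k₂ q : ℝ) (htbar : 0 < tbar) (hk₁ : 0 < k₁) (hk₂ : 0 < k₂) (hq : 0 < q)
    (hF1a : ∀ t ∈ Set.Icc (0:ℝ) tbar, k₁ * t ^ q ≤ f t)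
    (hF1b : ∀ t ≥ (0:ℝ), f t ≤ k₂ * t ^ q)
    -- condition (nu)
    (hnu : Tendsto (fun t : ℝ => t ^ q / ψ t) (nhdsWithin 0 (Set.Ioi 0)) atTop)
    (lam : ℝ) (hlam : 0 < lam) :
    ∃ u u' : ℝ → ℝ,
      IsSol a b φ (fun x => lam * m x * f (u x)) u u' ∧
      (∀ x ∈ Set.Icc a b, 0 ≤ u x) ∧ ∃ x ∈ Set.Icc a b, u x ≠ 0 := by
  classical
  have hφ0 : φ 0 = 0 := by have := hodd 0; simp at this; linarith
  have hf00 : f 0 = 0 := by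
    have h1 := hF1b 0 le_rfl
    rw [Real.zero_rpow hq.ne', mul_zero] at h1
    exact le_antisymm h1 (hf0 0 le_rfl)
  -- inverse of φ
  let e := StrictMono.orderIsoOfSurjective φ hmono hsurj
  let φi : ℝ → ℝ := fun x => e.symm x
  have hφφi : ∀ x, φ (φi x) = x := fun x => e.apply_symm_apply x
  have hφiφ : ∀ x, φi (φ x) = x := fun x => e.symm_apply_apply x
  have hφic : Continuous φi := e.symm.continuous
  have hφim : Monotone φi := e.symm.monotone
  have hφio : ∀ x, φi (-x) = - φi x := fun x => by
    apply hmono.injective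
    rw [hodd, hφφi, hφφi]
  -- globally integrable weight
  let M : ℝ → ℝ := (Ioc a b).indicator m
  have hMi : Integrable M := by
    rw [integrable_indicator_iff measurableSet_Ioc]
    exact (integrableOn_Ioc_iff_integrableOn_Ioo).2 hm
  have hMe : ∀ x ∈ Ioc a b, M x = m x := fun x hx => indicator_of_mem hx m
  -- the point x₀ and radius η
  obtain ⟨x₀, η, hη, hηl, hηr, hJpos⟩ : ∃ x₀ η : ℝ, 0 < η ∧ a₀ < x₀ - 4 * η ∧ x₀ + 4 * η < b₀ ∧
      0 < ∫ x in Ioc (x₀ - η) (x₀ + η), M x := by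
    let Z : Set ℝ := {x | m x ≠ 0} ∩ Ioo a₀ b₀
    have hZ : volume Z ≠ 0 := by
      intro h
      apply hmne
      rw [ae_iff, Measure.restrict_apply₀']
      · exact h
      · exact measurableSet_Ioo.nullMeasurableSet
    obtain ⟨x₀, hx₀, hx₀t⟩ := exists_mem_forall_mem_nhdsWithin_pos_measure hZ
    have hx1 := hx₀.2.1
    have hx2 := hx₀.2.2
    let η := min (x₀ - a₀) (b₀ - x₀) / 8
    have hmin : 0 < min (x₀ - a₀) (b₀ - x₀) := lt_min (by linarith) (by linarith)
    have hη : 0 < η := by positivity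
    have e8 : 8 * η = min (x₀ - a₀) (b₀ - x₀) := by simp only [η]; ring
    have h1 := min_le_left (x₀ - a₀) (b₀ - x₀)
    have h2 := min_le_right (x₀ - a₀) (b₀ - x₀)
    refine ⟨x₀, η, hη, by linarith, by linarith, ?_⟩
    have hsub : Ioc (x₀ - η) (x₀ + η) ⊆ Ioo a₀ b₀ := fun x hx =>
      ⟨by linarith [hx.1], by linarith [hx.2]⟩
    rw [setIntegral_pos_iff_support_of_nonneg_ae _ hMi.integrableOn]
    · apply hx₀t
      have hnb : Ioc (x₀ - η) (x₀ + η) ∈ nhds x₀ := Ioc_mem_nhds (by linarith) (by linarith)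
      filter_upwards [self_mem_nhdsWithin, mem_nhdsWithin_of_mem_nhds hnb] with x hx hx'
      refine ⟨?_, hx'⟩
      rw [Function.mem_support, hMe x ⟨by linarith [hx.2.1], by linarith [hx.2.2]⟩]
      exact hx.1
    · have := ae_restrict_of_ae_restrict_of_subset hsub hm0
      filter_upwards [this, ae_restrict_mem measurableSet_Ioc] with x hx hx'
      have hx'' := hsub hx'
      rw [hMe x ⟨by linarith [hx''.1], by linarith [hx''.2]⟩]
      exact hx
  have hM0 : ∀ᵐ x, x ∈ Ioo a₀ b₀ → 0 ≤ M x := by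
    filter_upwards [(ae_restrict_iff' measurableSet_Ioo).1 hm0] with x hx hx'
    rw [hMe x ⟨by linarith [hx'.1], by linarith [hx'.2]⟩]
    exact hx hx'
  set μ := ∫ x in Ioc (x₀ - η) (x₀ + η), M x with hμ
  -- the upper truncation level
  set N := ∫ x, |M x| with hN
  have hN0 : 0 ≤ N := integral_nonneg fun _ => abs_nonneg _
  have hba : 0 < b - a := by linarith
  obtain ⟨T, hT, hTφ⟩ := growth_large φ hodd hmono t₁ ht₁ ψ hψmono hψ0 hH1 q hnu
    (2 * (lam * k₂ * (b - a) ^ q * N) + 1) (by positivity)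
  set S := (b - a) * T with hS
  have hS0 : 0 < S := by positivity
  set B := lam * (k₂ * S ^ q) with hB
  set R := B * N with hR
  have hRT : φi (2 * R) ≤ T := by
    rw [← hφiφ T]
    apply hφim
    refine le_trans ?_ hTφ
    have : S ^ q = (b - a) ^ q * T ^ q := Real.mul_rpow hba.le hT.le
    rw [hR, hB, this]
    have : 0 ≤ T ^ q := by positivity
    nlinarith
  -- the subsolution
  obtain ⟨s, hs, hsσ, hsφ⟩ := growth_small φ hodd hmono t₁ ht₁ ψ hψmono hψ0 hH1 q hnu
    (lam * k₁ * η ^ q * μ / 2) (min tbar S / (6 * η)) (by positivity)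
    (div_pos (lt_min htbar hS0) (by positivity))
  rw [lt_div_iff₀ (by positivity)] at hsσ
  have hs1 : 6 * s * η ≤ tbar := by linarith [min_le_left tbar S]
  have hs2 : 6 * s * η ≤ S := by linarith [min_le_right tbar S]
  have hφs : 0 < φ s := by rw [← hφ0]; exact hmono hs
  set δ := 2 * φ s / μ with hδ
  have hδ0 : 0 < δ := by positivity
  have hδle : δ ≤ lam * (k₁ * (s * η) ^ q) := by
    rw [hδ, div_le_iff₀ hJpos, Real.mul_rpow hs.le hη.le]
    linarith
  let k : ℝ → ℝ := (Ioc (x₀ - η) (x₀ + η)).indicator (fun x => δ * M x)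
  have hki : Integrable k := (hMi.const_mul δ).indicator measurableSet_Ioc
  have hk0 : 0 ≤ᵐ[volume] k := by
    filter_upwards [hM0] with x hx
    by_cases hxJ : x ∈ Ioc (x₀ - η) (x₀ + η)
    · simp only [k, indicator_of_mem hxJ, Pi.zero_apply]
      exact mul_nonneg hδ0.le (hx ⟨by linarith [hxJ.1], by linarith [hxJ.2]⟩)
    · simp [k, indicator_of_notMem hxJ]
  have hkI : ∫ x, k x = 2 * φ s := by
    simp only [k]
    rw [integral_indicator measurableSet_Ioc, integral_const_mul, ← hμ, hδ]
    field_simp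
  obtain ⟨w, hwd, hwJ, hwl, hwr, hwS⟩ := sub_aux φi k hφic hφim (φ s) s x₀ η hη hs.le (hφiφ s)
    (by rw [hφio, hφiφ]) hki hk0 (fun x hx => indicator_of_notMem hx _) hkI
  have hwc : Continuous w := continuous_iff_continuousAt.2 fun x => (hwd x).continuousAt
  -- truncated nonlinearity
  let cl : ℝ → ℝ → ℝ := fun x y => max (max 0 (w x)) (min y S)
  have hcl0 : ∀ x y, 0 ≤ cl x y := fun x y => (le_max_left 0 (w x)).trans (le_max_left _ _)
  have hclS : ∀ x y, cl x y ≤ S := fun x y =>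
    max_le (max_le hS0.le ((hwS x).trans hs2)) (min_le_right _ _)
  let g : ℝ → ℝ → ℝ := fun x y => lam * f (cl x y)
  have hgc : Continuous (Function.uncurry g) := by
    apply continuous_const.mul
    apply hfc.comp_continuous
    · show Continuous (fun p : ℝ × ℝ => max (max 0 (w p.1)) (min p.2 S))
      fun_prop
    · exact fun p => hcl0 _ _
  have hg0 : ∀ x y, 0 ≤ g x y := fun x y => mul_nonneg hlam.le (hf0 _ (hcl0 x y))
  have hgB : ∀ x y, |g x y| ≤ B := fun x y => by
    rw [abs_of_nonneg (hg0 x y)]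
    apply mul_le_mul_of_nonneg_left _ hlam.le
    refine (hF1b _ (hcl0 x y)).trans (mul_le_mul_of_nonneg_left ?_ hk₂.le)
    exact Real.rpow_le_rpow (hcl0 x y) (hclS x y) hq.le
  obtain ⟨c, hc, u, huc, hub, hu⟩ := exists_bvp a b hab φi M g hφic hφim hφio hMi hgc B R hgB le_rfl
  have hvc : Continuous (fun r => g r (u r)) := hgc.comp (continuous_id.prodMk huc)
  have hMg : Integrable (fun r => M r * g r (u r)) :=
    inner_integrable M _ hMi hvc B (fun x => hgB _ _)
  let I : ℝ → ℝ := fun t => ∫ r in a..t, M r * g r (u r)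
  have hIb : ∀ t, |I t| ≤ R := fun t => inner_bound M _ hMi hvc B (fun x => hgB _ _) a t
  have hIc : Continuous I := intervalIntegral.continuous_primitive (fun x y => hMg.intervalIntegrable) a
  have hId : ∀ x y, I y - I x = ∫ r in x..y, M r * g r (u r) := fun x y =>
    intervalIntegral.integral_interval_sub_left hMg.intervalIntegrable hMg.intervalIntegrable
  let u' : ℝ → ℝ := fun t => φi (c - I t)
  have hu'c : Continuous u' := hφic.comp (continuous_const.sub hIc)
  have hu'φ : ∀ t, φ (u' t) = c - I t := fun t => hφφi _
  have hu'b : ∀ t, |u' t| ≤ T := by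
    intro t
    refine le_trans ?_ hRT
    have h1 := abs_le.1 (hIb t)
    rw [abs_le, ← hφio]
    exact ⟨hφim (by linarith [hc.1]), hφim (by linarith [hc.2])⟩
  have hua : u a = 0 := by rw [hu a ⟨le_rfl, hab.le⟩]; simp
  have huW : ∀ x ∈ Icc a b, HasDerivWithinAt u (u' x) (Icc a b) x := by
    intro x hx
    exact (hu'c.integral_hasStrictDerivAt a x).hasDerivAt.hasDerivWithinAt.congr hu (hu x hx)
  have huD : ∀ x ∈ Ioo a b, HasDerivAt u (u' x) x := fun x hx =>
    (huW x ⟨hx.1.le, hx.2.le⟩).hasDerivAt (Icc_mem_nhds hx.1 hx.2)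
  have huS : ∀ x ∈ Icc a b, u x ≤ S := by
    intro x hx
    rw [hu x hx]
    have h1 : ‖∫ t in a..x, u' t‖ ≤ T * |x - a| :=
      intervalIntegral.norm_integral_le_of_norm_le_const fun t _ => hu'b t
    rw [abs_of_nonneg (by linarith [hx.1])] at h1
    have h2 := (le_abs_self _).trans h1
    refine h2.trans ?_
    rw [hS, mul_comm]
    exact mul_le_mul_of_nonneg_right (by linarith [hx.2]) hT.le
  -- nonnegativity
  have hnn : ∀ x ∈ Icc a b, 0 ≤ u x := by
    refine comp_aux φ hmono a b u (fun _ => 0) u' (fun _ => 0) huc.continuousOn continuousOn_const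
      huD (fun x _ => hasDerivAt_const x 0) hua.ge hub.ge ?_
    intro x y hx hxy hy hlt
    rw [hu'φ, hu'φ]
    have h1 : 0 ≤ I y - I x := by
      rw [hId, intervalIntegral.integral_of_le hxy]
      apply integral_nonneg_of_ae
      filter_upwards [ae_restrict_of_ae hM0, ae_restrict_mem measurableSet_Ioc] with t ht ht'
      by_cases h : t ∈ Ioo a₀ b₀
      · exact mul_nonneg (ht h) (hg0 _ _)
      · have hwt : w t ≤ 0 := by
          rw [mem_Ioo, not_and_or, not_lt, not_lt] at h
          rcases h with h | h
          · exact hwl t (by linarith)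
          · exact hwr t (by linarith)
        have hut := hlt t ⟨ht'.1.le, ht'.2⟩
        have hcl : cl t (u t) = 0 := by
          simp only [cl]
          rw [max_eq_left hwt, max_eq_left]
          exact (min_le_left _ _).trans hut.le
        simp [g, hcl, hf00]
    simp only [sub_self]
    linarith
  -- comparison with the subsolution
  have hpr : Icc (x₀ - 4 * η) (x₀ + 4 * η) ⊆ Ioo a₀ b₀ := fun x hx =>
    ⟨by linarith [hx.1], by linarith [hx.2]⟩
  have hpr' : ∀ x ∈ Icc (x₀ - 4 * η) (x₀ + 4 * η), x ∈ Ioo a b := fun x hx =>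
    ⟨by linarith [(hpr hx).1], by linarith [(hpr hx).2]⟩
  have hcmp : ∀ x ∈ Icc (x₀ - 4 * η) (x₀ + 4 * η), w x ≤ u x := by
    refine comp_aux φ hmono _ _ u w u' (fun x => φi (φ s - ∫ t in Iic x, k t)) huc.continuousOn
      hwc.continuousOn (fun x hx => huD x (hpr' x ⟨hx.1.le, hx.2.le⟩)) (fun x _ => hwd x) ?_ ?_ ?_
    · refine (hwl _ le_rfl).trans (hnn _ (Ioo_subset_Icc_self (hpr' _ ⟨le_rfl, by linarith⟩)))
    · refine (hwr _ le_rfl).trans (hnn _ (Ioo_subset_Icc_self (hpr' _ ⟨by linarith, le_rfl⟩)))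
    intro x y hx hxy hy hlt
    simp only [hu'φ, hφφi]
    have h1 : (∫ t in Iic y, k t) - ∫ t in Iic x, k t ≤ I y - I x := by
      rw [hId, intervalIntegral.integral_Iic_sub_Iic hki.integrableOn hki.integrableOn,
        intervalIntegral.integral_of_le hxy, intervalIntegral.integral_of_le hxy]
      apply integral_mono_ae hki.integrableOn hMg.integrableOn
      filter_upwards [ae_restrict_of_ae hM0, ae_restrict_mem measurableSet_Ioc] with t ht ht'
      have htp : t ∈ Icc (x₀ - 4 * η) (x₀ + 4 * η) := ⟨by linarith [ht'.1], by linarith [ht'.2]⟩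
      have hMt := ht (hpr htp)
      by_cases hJ : t ∈ Ioc (x₀ - η) (x₀ + η)
      · simp only [k, indicator_of_mem hJ]
        rw [mul_comm]
        apply mul_le_mul_of_nonneg_left _ hMt
        have hut := hlt t ⟨ht'.1.le, ht'.2⟩
        have hw1 := hwJ t ⟨hJ.1.le, hJ.2⟩
        have hsη : 0 < s * η := by positivity
        have hcl : cl t (u t) = w t := by
          simp only [cl]
          rw [max_eq_right (by linarith : 0 ≤ w t), max_eq_left]
          exact (min_le_left _ _).trans hut.le
        simp only [g, hcl]
        refine hδle.trans (mul_le_mul_of_nonneg_left ?_ hlam.le)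
        refine le_trans ?_ (hF1a (w t) ⟨by linarith, (hwS t).trans hs1⟩)
        exact mul_le_mul_of_nonneg_left (Real.rpow_le_rpow hsη.le hw1 hq.le) hk₁.le
      · simp only [k, indicator_of_notMem hJ]
        exact mul_nonneg hMt (hg0 _ _)
    linarith
  have hclu : ∀ x ∈ Icc a b, cl x (u x) = u x := by
    intro x hx
    have h1 : w x ≤ u x := by
      by_cases h : x ∈ Icc (x₀ - 4 * η) (x₀ + 4 * η)
      · exact hcmp x h
      · refine le_trans ?_ (hnn x hx)
        rw [mem_Icc, not_and_or, not_le, not_le] at h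
        rcases h with h | h
        · exact hwl x h.le
        · exact hwr x h.le
    simp only [cl]
    rw [min_eq_left (huS x hx), max_eq_right (max_le (hnn x hx) h1)]
  refine ⟨u, u', ⟨hua, hub, hu'c.continuousOn, huW, ?_⟩, hnn, x₀, ?_, ?_⟩
  · intro x hx
    rw [hu'φ, hu'φ]
    have h1 : I a = 0 := by simp [I]
    have h2 : I x = ∫ t in a..x, lam * m t * f (u t) := by
      simp only [I]
      rw [intervalIntegral.integral_of_le hx.1, intervalIntegral.integral_of_le hx.1]
      apply setIntegral_congr_fun measurableSet_Ioc
      intro t ht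
      have ht' : t ∈ Icc a b := ⟨ht.1.le, ht.2.trans hx.2⟩
      simp only [g]
      rw [hclu t ht', hMe t ⟨ht.1, ht'.2⟩]
      ring
    rw [h1, h2]
    ring
  · exact Ioo_subset_Icc_self (hpr' x₀ ⟨by linarith, by linarith⟩)
  · have h1 := hwJ x₀ ⟨by linarith, by linarith⟩
    have h2 := hcmp x₀ ⟨by linarith, by linarith⟩
    have : 0 < s * η := by positivity
    linarith
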